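/- For every real α ∈ (0, 1] there is a constant C > 0 such that for every integer n ≥ 4 with ⌊n^α⌋ ≥ 2, ldim(Q(n; 1, ⌊n^α⌋)) ≥ (1 − α) · n^α − C · n^α · log log n / (log n)², and likewise ldim(Q(n; 1, n − ⌊n^α⌋)) ≥ (1 − α) · n^α − C · n^α · log log n / (log n)². -/

import Mathlib

open scoped Classical

namespace PaperLD

/-- A partial linear extension of a poset `α`: a duplicate-free list whose
listing order extends the partial order on the elements it contains. -/
structure PLE (α : Type*) [PartialOrder α] where
  toList : List α
  nodup : toList.Nodup
  le_imp : ∀ i j : Fin toList.length, toList.get i ≤ toList.get j → i ≤ j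

/-- `x` occurs (weakly) before `y` in the partial linear extension `L`
(in particular both `x` and `y` belong to the ground set of `L`). -/
def PLE.Before {α : Type*} [PartialOrder α] (L : PLE α) (x y : α) : Prop :=
  ∃ i j : Fin L.toList.length, i ≤ j ∧ L.toList.get i = x ∧ L.toList.get j = y

/-- A family of partial linear extensions is a local realiser if, for every
ordered pair `(x, y)` with `x ≱ y`, some member lists `x` before `y`. -/
def IsLocalRealiser {α : Type*} [PartialOrder α] {ι : Type*} (F : ι → PLE α) : Prop :=
  ∀ x y : α, ¬ y ≤ x → ∃ i, (F i).Before x y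

/-- The multiplicity of `x` in a finite family of partial linear extensions:
the number of members whose ground set contains `x`. -/
noncomputable def mult {α : Type*} [PartialOrder α] {N : ℕ} (F : Fin N → PLE α) (x : α) : ℕ :=
  (Finset.univ.filter fun i => x ∈ (F i).toList).card

/-- The local dimension of a finite poset: the least `d` such that there is a
local realiser in which every element has multiplicity at most `d`. -/
noncomputable def ldim (α : Type*) [PartialOrder α] [Fintype α] : ℕ :=
  sInf {d | ∃ (N : ℕ) (F : Fin N → PLE α), IsLocalRealiser F ∧ ∀ x : α, mult F x ≤ d}

/-- The order dimension of a finite poset: the least `d` such that some family of `d`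
linear extensions (partial linear extensions containing every element) is a realiser. -/
noncomputable def odim (α : Type*) [PartialOrder α] [Fintype α] : ℕ :=
  sInf {d | ∃ F : Fin d → PLE α, (∀ i, ∀ x : α, x ∈ (F i).toList) ∧ IsLocalRealiser F}

/-- `BoolLayers n ℓ k` is the suborder of the Boolean lattice `Q(n)` induced by the
`ℓ`-th and `k`-th layers: all subsets of an `n`-set of cardinality `ℓ` or `k`,
ordered by inclusion. -/
abbrev BoolLayers (n ℓ k : ℕ) := {s : Finset (Fin n) // s.card = ℓ ∨ s.card = k}

end PaperLD

open PaperLD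

namespace PaperLD

section Position

variable {β : Type*} [PartialOrder β]

/-- The position at which `x` is listed by `L` (the length of `L` if it is not listed). -/
noncomputable def PLE.pos (L : PLE β) (x : β) : ℕ := L.toList.idxOf x

lemma PLE.before_iff (L : PLE β) (x y : β) :
    L.Before x y ↔ x ∈ L.toList ∧ y ∈ L.toList ∧ L.pos x ≤ L.pos y := by
  constructor
  · rintro ⟨i, j, hij, rfl, rfl⟩
    refine ⟨List.get_mem _ _, List.get_mem _ _, ?_⟩
    simpa [PLE.pos, L.nodup.idxOf_getElem] using hij
  · rintro ⟨hx, hy, h⟩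
    exact ⟨⟨L.pos x, List.idxOf_lt_length_of_mem hx⟩, ⟨L.pos y, List.idxOf_lt_length_of_mem hy⟩,
      h, by simp [PLE.pos], by simp [PLE.pos]⟩

lemma PLE.pos_le_of_le (L : PLE β) {x y : β} (hx : x ∈ L.toList) (hy : y ∈ L.toList)
    (h : x ≤ y) : L.pos x ≤ L.pos y := by
  have := L.le_imp ⟨L.pos x, List.idxOf_lt_length_of_mem hx⟩
    ⟨L.pos y, List.idxOf_lt_length_of_mem hy⟩ (by simpa [PLE.pos] using h)
  exact this

lemma PLE.pos_inj (L : PLE β) {x y : β} (hx : x ∈ L.toList) (h : L.pos x = L.pos y) : x = y :=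
  (List.idxOf_inj hx).1 h

/-- The partial linear extension listing only `x` and then `y`. -/
def PLE.pair (x y : β) (h : ¬ y ≤ x) : PLE β where
  toList := [x, y]
  nodup := by
    have : x ≠ y := fun e => h e.ge
    simp [this]
  le_imp := by
    intro i j
    fin_cases i <;> fin_cases j <;> simp [h]

lemma PLE.pair_before (x y : β) (h : ¬ y ≤ x) : (PLE.pair x y h).Before x y :=
  ⟨⟨0, by simp [PLE.pair]⟩, ⟨1, by simp [PLE.pair]⟩, by simp, rfl, rfl⟩

lemma exists_isLocalRealiser_mult_le_ldim (β : Type*) [PartialOrder β] [Fintype β] :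
    ∃ (N : ℕ) (F : Fin N → PLE β), IsLocalRealiser F ∧ ∀ x : β, mult F x ≤ ldim β := by
  have hne : {d | ∃ (N : ℕ) (F : Fin N → PLE β),
      IsLocalRealiser F ∧ ∀ x : β, mult F x ≤ d}.Nonempty := by
    let e := Fintype.equivFin {p : β × β // ¬ p.2 ≤ p.1}
    refine ⟨_, _, fun i => PLE.pair (e.symm i).1.1 (e.symm i).1.2 (e.symm i).2, ?_,
      fun x => Finset.card_le_univ _⟩
    intro x y h
    refine ⟨e ⟨(x, y), h⟩, ?_⟩
    simpa using PLE.pair_before x y h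
  exact Nat.sInf_mem hne

end Position

section Counting

variable {n k N : ℕ}

/-- The singleton `{x}` as an element of `BoolLayers n 1 k`. -/
def singletonLayer (k : ℕ) (x : Fin n) : BoolLayers n 1 k := ⟨{x}, Or.inl (by simp)⟩

lemma singletonLayer_injective : Function.Injective (singletonLayer (n := n) k) := by
  intro x y h
  simpa [singletonLayer] using h

/-- The pairs `(i, x)` such that `{x}` is the first singleton listed after `s` by `F i`. -/
noncomputable def firstSingletons (F : Fin N → PLE (BoolLayers n 1 k)) (s : BoolLayers n 1 k) :
    Finset (Fin N × Fin n) :=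
  Finset.univ.filter fun p => (F p.1).Before s (singletonLayer k p.2) ∧
    ∀ y, (F p.1).Before s (singletonLayer k y) →
      (F p.1).Before (singletonLayer k p.2) (singletonLayer k y)

lemma card_firstSingletons_le (F : Fin N → PLE (BoolLayers n 1 k)) (s : BoolLayers n 1 k) :
    (firstSingletons F s).card ≤ mult F s := by
  refine Finset.card_le_card_of_injOn Prod.fst ?_ ?_
  · intro p hp
    simp only [firstSingletons, Finset.coe_filter, Finset.mem_univ, true_and,
      Set.mem_ofPred_eq] at hp ⊢
    exact ((PLE.before_iff _ _ _).1 hp.1).1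
  · rintro ⟨i, x⟩ hp ⟨j, y⟩ hq hij
    simp only [firstSingletons, Finset.coe_filter, Finset.mem_univ, true_and,
      Set.mem_ofPred_eq] at hp hq hij
    subst hij
    have h₁ := (PLE.before_iff _ _ _).1 (hp.2 y hq.1)
    have h₂ := (PLE.before_iff _ _ _).1 (hq.2 x hp.1)
    rw [singletonLayer_injective (PLE.pos_inj _ h₁.1 (le_antisymm h₁.2.2 h₂.2.2))]

lemma notMem_iff_exists_firstSingletons {F : Fin N → PLE (BoolLayers n 1 k)}
    (hF : IsLocalRealiser F) {s : BoolLayers n 1 k} (hs : s.1.card ≠ 1) (y : Fin n) :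
    y ∉ s.1 ↔ ∃ p ∈ firstSingletons F s,
      (F p.1).Before (singletonLayer k p.2) (singletonLayer k y) := by
  constructor
  · intro hy
    obtain ⟨i, hi⟩ := hF s (singletonLayer k y) (by
      intro h
      exact hy (Finset.singleton_subset_iff.1 h))
    obtain ⟨x, hx, hmin⟩ := Finset.exists_min_image
      (Finset.univ.filter fun z => (F i).Before s (singletonLayer k z))
      (fun z => (F i).pos (singletonLayer k z)) ⟨y, by simpa using hi⟩
    simp only [Finset.mem_filter, Finset.mem_univ, true_and] at hx hmin
    have hfirst : ∀ z, (F i).Before s (singletonLayer k z) →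
        (F i).Before (singletonLayer k x) (singletonLayer k z) := fun z hz =>
      (PLE.before_iff _ _ _).2 ⟨((PLE.before_iff _ _ _).1 hx).2.1,
        ((PLE.before_iff _ _ _).1 hz).2.1, hmin z hz⟩
    exact ⟨(i, x), by simpa [firstSingletons] using ⟨hx, hfirst⟩, hfirst y hi⟩
  · rintro ⟨⟨i, x⟩, hp, hxy⟩ hy
    simp only [firstSingletons, Finset.mem_filter, Finset.mem_univ, true_and] at hp hxy
    have h₁ := (PLE.before_iff _ _ _).1 hp.1
    have h₂ := (PLE.before_iff _ _ _).1 hxy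
    have h₃ := (F i).pos_le_of_le h₂.2.1 h₁.1
      (show singletonLayer k y ≤ s from Finset.singleton_subset_iff.2 hy)
    have h₄ := (F i).pos_inj h₁.1 (le_antisymm (h₁.2.2.trans h₂.2.2) h₃)
    exact hs (by simp [h₄, singletonLayer])

lemma card_filter_card_le_le {γ : Type*} (P : Finset γ) (hn : 0 < n) (d : ℕ)
    (hP : P.card ≤ n * d) :
    ((P.powerset.filter fun T => T.card ≤ d).card : ℝ) ≤ (Real.exp 1 * n) ^ d := by
  have hn' : (0 : ℝ) < n := by exact_mod_cast hn
  have hn1 : (1 : ℝ) ≤ n := by exact_mod_cast hn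
  calc ((P.powerset.filter fun T => T.card ≤ d).card : ℝ)
      = ∑ T ∈ P.powerset.filter fun T => T.card ≤ d, (1 : ℝ) := by simp
    _ ≤ ∑ T ∈ P.powerset.filter fun T => T.card ≤ d, (n : ℝ) ^ d * (1 / n : ℝ) ^ T.card := by
        refine Finset.sum_le_sum fun T hT => ?_
        have hT' := (Finset.mem_filter.1 hT).2
        rw [one_div, inv_pow, ← div_eq_mul_inv, le_div_iff₀ (by positivity), one_mul]
        exact pow_le_pow_right₀ hn1 hT'
    _ ≤ ∑ T ∈ P.powerset, (n : ℝ) ^ d * (1 / n : ℝ) ^ T.card :=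
        Finset.sum_le_sum_of_subset_of_nonneg (Finset.filter_subset _ _)
          fun _ _ _ => by positivity
    _ = (n : ℝ) ^ d * (1 / n + 1 : ℝ) ^ P.card := by
        rw [← Finset.mul_sum, ← Finset.sum_pow_mul_eq_add_pow]
        simp
    _ ≤ (n : ℝ) ^ d * (1 / n + 1 : ℝ) ^ (n * d) := by
        gcongr
        simp
    _ ≤ (n : ℝ) ^ d * (Real.exp (1 / n)) ^ (n * d) := by
        gcongr
        exact Real.add_one_le_exp _
    _ = (Real.exp 1 * n) ^ d := by
        rw [pow_mul, ← Real.exp_nat_mul, mul_one_div_cancel hn'.ne', mul_pow, mul_comm]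

lemma choose_le_of_isLocalRealiser {F : Fin N → PLE (BoolLayers n 1 k)}
    (hF : IsLocalRealiser F) (hn : 0 < n) (hk : k ≠ 1) {d : ℕ} (hd : ∀ x, mult F x ≤ d) :
    (n.choose k : ℝ) ≤ (Real.exp 1 * n) ^ d := by
  let P : Finset (Fin N × Fin n) :=
    Finset.univ.filter fun p => singletonLayer k p.2 ∈ (F p.1).toList
  have hP : P.card ≤ n * d := by
    calc P.card = ∑ x : Fin n, (P.filter fun p => p.2 = x).card :=
          Finset.card_eq_sum_card_fiberwise fun p _ => Finset.mem_univ _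
      _ ≤ ∑ x : Fin n, d := by
          refine Finset.sum_le_sum fun x _ => le_trans ?_ (hd (singletonLayer k x))
          refine Finset.card_le_card_of_injOn Prod.fst ?_ ?_
          · rintro ⟨i, y⟩ hp
            simp only [P, Finset.coe_filter, Finset.mem_filter, Finset.mem_univ, true_and,
              Set.mem_ofPred_eq] at hp ⊢
            rw [← hp.2]
            exact hp.1
          · rintro ⟨i, y⟩ hp ⟨j, z⟩ hq hij
            simp only [Finset.coe_filter, Set.mem_ofPred_eq] at hp hq hij
            rw [hij, hp.2, hq.2]
      _ = n * d := by simp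
  refine le_trans ?_ (card_filter_card_le_le P hn d hP)
  have hcard : n.choose k = (Finset.univ.filter fun s : BoolLayers n 1 k => s.1.card = k).card := by
    have h := Finset.card_powersetCard k (Finset.univ : Finset (Fin n))
    rw [Finset.card_univ, Fintype.card_fin] at h
    rw [← h]
    symm
    refine Finset.card_bij (fun s _ => s.1) ?_ ?_ ?_
    · intro s hs
      simpa [Finset.mem_powersetCard] using hs
    · intro s _ t _ h
      exact Subtype.ext h
    · intro s hs
      have hs' := (Finset.mem_powersetCard.1 hs).2
      exact ⟨⟨s, Or.inr hs'⟩, by simpa using hs', rfl⟩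
  rw [hcard]
  norm_cast
  refine Finset.card_le_card_of_injOn (firstSingletons F) ?_ ?_
  · intro s _
    simp only [Finset.coe_filter, Finset.mem_powerset, Set.mem_ofPred_eq]
    refine ⟨fun p hp => ?_, (card_firstSingletons_le F s).trans (hd s)⟩
    simp only [firstSingletons, Finset.mem_filter, Finset.mem_univ, true_and] at hp
    simpa [P] using ((PLE.before_iff _ _ _).1 hp.1).2.1
  · intro s hs t ht hst
    simp only [Finset.coe_filter, Finset.mem_univ, true_and, Set.mem_ofPred_eq] at hs ht
    refine Subtype.ext (Finset.ext fun y => not_iff_not.1 ?_)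
    rw [notMem_iff_exists_firstSingletons hF (hs.trans_ne hk),
      notMem_iff_exists_firstSingletons hF (ht.trans_ne hk), hst]

lemma log_choose_le_ldim_mul (hn : 0 < n) (hk : k ≠ 1) (hkn : k ≤ n) :
    Real.log (n.choose k) ≤ ldim (BoolLayers n 1 k) * (1 + Real.log n) := by
  obtain ⟨N, F, hF, hd⟩ := exists_isLocalRealiser_mult_le_ldim (BoolLayers n 1 k)
  have hpos : (0 : ℝ) < n.choose k := by exact_mod_cast Nat.choose_pos hkn
  have hn' : (n : ℝ) ≠ 0 := by exact_mod_cast hn.ne'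
  have h := Real.log_le_log hpos (choose_le_of_isLocalRealiser hF hn hk hd)
  rwa [Real.log_pow, Real.log_mul (Real.exp_ne_zero _) hn', Real.log_exp] at h

end Counting

section Estimates

lemma log_factorial_le {k : ℕ} (hk : 1 ≤ k) :
    Real.log (k.factorial) ≤ (k + 1) * Real.log k - k + 1 := by
  induction k, hk using Nat.le_induction with
  | base => simp
  | succ k hk ih =>
    have hk0 : (0 : ℝ) < k := by exact_mod_cast hk
    have h := Real.one_sub_inv_le_log_of_pos (show (0 : ℝ) < (k + 1) / k by positivity)
    rw [Real.log_div (by positivity) hk0.ne'] at h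
    have h' : 1 - ((k + 1 : ℝ) / k)⁻¹ = 1 / (k + 1) := by
      field_simp
      ring
    rw [h', div_le_iff₀ (by positivity)] at h
    rw [Nat.factorial_succ, Nat.cast_mul,
      Real.log_mul (by positivity) (by positivity)]
    push_cast
    linarith

lemma le_log_choose {n k : ℕ} (hk : 1 ≤ k) (hkn : 2 * k ≤ n) :
    k * Real.log n - 2 * k ^ 2 / n - (k + 1) * Real.log k + k - 1 ≤ Real.log (n.choose k) := by
  have hk0 : (1 : ℝ) ≤ k := by exact_mod_cast hk
  have hkn' : (2 : ℝ) * k ≤ n := by exact_mod_cast hkn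
  have hn0 : (0 : ℝ) < n := by linarith
  have hm : (0 : ℝ) < n + 1 - k := by linarith
  have hchoose : (0 : ℝ) < n.choose k := by exact_mod_cast Nat.choose_pos (by omega)
  have h₁ : ((n : ℝ) + 1 - k) ^ k ≤ k.factorial * n.choose k := by
    have h := Nat.pow_sub_le_descFactorial n k
    rw [Nat.descFactorial_eq_factorial_mul_choose] at h
    have h' : (((n + 1 - k : ℕ) : ℝ)) ^ k ≤ k.factorial * n.choose k := by exact_mod_cast h
    rwa [Nat.cast_sub (by omega), Nat.cast_add, Nat.cast_one] at h'
  have h₂ := Real.log_le_log (by positivity) h₁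
  rw [Real.log_pow, Real.log_mul (by positivity) hchoose.ne'] at h₂
  have h₃ : Real.log n - 2 * k / n ≤ Real.log (n + 1 - k) := by
    have h := Real.one_sub_inv_le_log_of_pos (show (0 : ℝ) < (n + 1 - k) / n by positivity)
    rw [Real.log_div hm.ne' hn0.ne', inv_div] at h
    have h' : (n : ℝ) / (n + 1 - k) ≤ 1 + 2 * k / n := by
      rw [div_le_iff₀ hm]
      have : (1 + 2 * k / n : ℝ) * (n + 1 - k) = n + 1 - k + 2 * k * ((n + 1 - k) / n) := by
        field_simp
      rw [this]
      have h2 : (1 : ℝ) / 2 ≤ (n + 1 - k) / n := by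
        rw [div_le_div_iff₀ (by norm_num) hn0]
        linarith
      nlinarith
    linarith
  have h₄ := mul_le_mul_of_nonneg_left h₃ (show (0 : ℝ) ≤ k by linarith)
  have h₅ : (k : ℝ) * (Real.log n - 2 * k / n) = k * Real.log n - 2 * k ^ 2 / n := by
    ring
  have h₆ := log_factorial_le hk
  linarith

lemma le_of_log_choose_le {α : ℝ} (h0 : 0 < α) (h1 : α < 1) {n : ℕ} (hn : 4 ≤ n)
    (hk : 2 ≤ ⌊(n : ℝ) ^ α⌋₊) (hsmall : (n : ℝ) ^ α ≤ α / 8 * n)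
    (hlarge : 2 + Real.log n + α ≤ α / 2 * (n : ℝ) ^ α) {d : ℝ}
    (hd : Real.log (n.choose ⌊(n : ℝ) ^ α⌋₊) ≤ d * (1 + Real.log n)) :
    (1 - α) * (n : ℝ) ^ α ≤ d := by
  have hn0 : (0 : ℝ) < n := by exact_mod_cast (by omega : 0 < n)
  have hL : 0 ≤ Real.log n := Real.log_natCast_nonneg n
  have ht0 : 0 ≤ (n : ℝ) ^ α := by positivity
  have hkt : (⌊(n : ℝ) ^ α⌋₊ : ℝ) ≤ (n : ℝ) ^ α := Nat.floor_le ht0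
  have htk := Nat.lt_floor_add_one ((n : ℝ) ^ α)
  have hlog : Real.log ((n : ℝ) ^ α) = α * Real.log n := Real.log_rpow hn0 α
  generalize (n : ℝ) ^ α = t at *
  generalize ⌊t⌋₊ = k at *
  have hk2 : (2 : ℝ) ≤ k := by exact_mod_cast hk
  have hkn : 2 * k ≤ n := by
    have : (2 : ℝ) * k ≤ n := by nlinarith
    exact_mod_cast this
  have hlogk : Real.log k ≤ α * Real.log n := hlog ▸ Real.log_le_log (by linarith) hkt
  have hchoose := le_log_choose (by omega : 1 ≤ k) hkn
  have hsq : 2 * (k : ℝ) ^ 2 / n ≤ α / 4 * k := by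
    rw [div_le_iff₀ hn0]
    nlinarith
  have hlogk' := mul_le_mul_of_nonneg_left hlogk (show (0 : ℝ) ≤ k + 1 by linarith)
  have hmain : (1 - α) * (k + 1) * (1 + Real.log n) ≤ d * (1 + Real.log n) := by
    nlinarith
  have := le_of_mul_le_mul_right hmain (by linarith)
  nlinarith

open Filter in
lemma eventually_rpow_bounds {α : ℝ} (h0 : 0 < α) (h1 : α < 1) :
    ∀ᶠ n : ℕ in atTop, (n : ℝ) ^ α ≤ α / 8 * n ∧
      2 + Real.log n + α ≤ α / 2 * (n : ℝ) ^ α := by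
  have hlin : ∀ᶠ x : ℝ in atTop, x ^ α ≤ α / 8 * x := by
    have h := ((tendsto_rpow_atTop (sub_pos.2 h1)).const_mul_atTop
      (show 0 < α / 8 by positivity)).eventually_ge_atTop 1
    filter_upwards [h, eventually_gt_atTop 0] with x h hx
    calc x ^ α ≤ x ^ α * (α / 8 * x ^ (1 - α)) := le_mul_of_one_le_right (by positivity) h
      _ = α / 8 * x ^ (α + (1 - α)) := by rw [Real.rpow_add hx]; ring
      _ = α / 8 * x := by rw [add_sub_cancel, Real.rpow_one]
  have hlog := isLittleO_log_rpow_atTop h0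
  have hconst : ∀ᶠ x : ℝ in atTop, 2 + α ≤ α / 4 * x ^ α :=
    ((tendsto_rpow_atTop h0).const_mul_atTop (by positivity)).eventually_ge_atTop _
  have hreal : ∀ᶠ x : ℝ in atTop, x ^ α ≤ α / 8 * x ∧ 2 + Real.log x + α ≤ α / 2 * x ^ α := by
    filter_upwards [hlin, hlog.bound (show 0 < α / 4 by positivity), hconst, eventually_ge_atTop 1] with x h₁ h₂ h₃ hx
    have hx0 : 0 ≤ x := by linarith
    rw [Real.norm_of_nonneg (Real.log_nonneg hx), Real.norm_of_nonneg (by positivity)] at h₂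
    exact ⟨h₁, by linarith⟩
  exact tendsto_natCast_atTop_atTop.eventually hreal

lemma one_le_logb_logb {n : ℕ} (hn : 4 ≤ n) : 1 ≤ Real.logb 2 (Real.logb 2 n) := by
  have hn' : (4 : ℝ) ≤ n := by exact_mod_cast hn
  have h : 2 ≤ Real.logb 2 n := by
    rw [Real.le_logb_iff_rpow_le (by norm_num) (by linarith)]
    norm_num
    exact hn
  rw [Real.le_logb_iff_rpow_le (by norm_num) (by linarith)]
  simpa using h

end Estimates

end PaperLD

/-- For every `α ∈ (0, 1]` there is `C > 0` such that for every `n ≥ 4` with `⌊n^α⌋ ≥ 2`,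
both `ldim(Q(n; 1, ⌊n^α⌋))` and `ldim(Q(n; 1, n − ⌊n^α⌋))` are at least
`(1 − α)·n^α − C·n^α·log log n/(log n)²` (logs base 2). -/
theorem stmt7 (α : ℝ) (h0 : 0 < α) (h1 : α ≤ 1) :
    ∃ C : ℝ, 0 < C ∧ ∀ n : ℕ, 4 ≤ n → 2 ≤ ⌊(n : ℝ) ^ α⌋₊ →
      (1 - α) * (n : ℝ) ^ α -
          C * (n : ℝ) ^ α * Real.logb 2 (Real.logb 2 n) / (Real.logb 2 n) ^ 2 ≤
        (ldim (BoolLayers n 1 ⌊(n : ℝ) ^ α⌋₊) : ℝ) ∧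
      (1 - α) * (n : ℝ) ^ α -
          C * (n : ℝ) ^ α * Real.logb 2 (Real.logb 2 n) / (Real.logb 2 n) ^ 2 ≤
        (ldim (BoolLayers n 1 (n - ⌊(n : ℝ) ^ α⌋₊)) : ℝ) := by
  rcases h1.eq_or_lt with rfl | h1
  · refine ⟨1, one_pos, fun n hn _ => ?_⟩
    have hll := one_le_logb_logb hn
    have herr : 0 ≤ 1 * (n : ℝ) ^ (1 : ℝ) * Real.logb 2 (Real.logb 2 n) / (Real.logb 2 n) ^ 2 := by
      positivity
    exact ⟨by linarith [Nat.cast_nonneg (α := ℝ) (ldim (BoolLayers n 1 ⌊(n : ℝ) ^ (1 : ℝ)⌋₊))],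
      by linarith [Nat.cast_nonneg (α := ℝ) (ldim (BoolLayers n 1 (n - ⌊(n : ℝ) ^ (1 : ℝ)⌋₊)))]⟩
  obtain ⟨M, hM⟩ := Filter.eventually_atTop.1 (eventually_rpow_bounds h0 h1)
  refine ⟨(Real.logb 2 M) ^ 2 + 1, by positivity, fun n hn hk => ?_⟩
  have hll := one_le_logb_logb hn
  have ht : 0 ≤ (n : ℝ) ^ α := by positivity
  have hn' : (4 : ℝ) ≤ n := by exact_mod_cast hn
  rcases le_or_gt M n with hMn | hMn
  · obtain ⟨hsmall, hlarge⟩ := hM n hMn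
    have herr : 0 ≤ ((Real.logb 2 M) ^ 2 + 1) * (n : ℝ) ^ α * Real.logb 2 (Real.logb 2 n) /
        (Real.logb 2 n) ^ 2 := by
      positivity
    have hkn : 8 * ⌊(n : ℝ) ^ α⌋₊ ≤ n := by
      have := Nat.floor_le ht
      have : (8 : ℝ) * ⌊(n : ℝ) ^ α⌋₊ ≤ n := by nlinarith
      exact_mod_cast this
    have hfst := le_of_log_choose_le h0 h1 hn hk hsmall hlarge
      (log_choose_le_ldim_mul (by omega) (by omega) (by omega))
    have hsnd := le_of_log_choose_le h0 h1 hn hk hsmall hlarge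
      (d := ldim (BoolLayers n 1 (n - ⌊(n : ℝ) ^ α⌋₊)))
      (by
        rw [← Nat.choose_symm (by omega)]
        exact log_choose_le_ldim_mul (by omega) (by omega) (by omega))
    exact ⟨by linarith, by linarith⟩
  · have hlog : 0 < Real.logb 2 n := Real.logb_pos (by norm_num) (by linarith)
    have hlogM : Real.logb 2 n ≤ Real.logb 2 M :=
      Real.logb_le_logb_of_le (by norm_num) (by linarith) (by exact_mod_cast hMn.le)
    have herr : (n : ℝ) ^ α ≤ ((Real.logb 2 M) ^ 2 + 1) * (n : ℝ) ^ α *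
        Real.logb 2 (Real.logb 2 n) / (Real.logb 2 n) ^ 2 := by
      rw [le_div_iff₀ (by positivity)]
      have hsq : (Real.logb 2 n) ^ 2 ≤ (Real.logb 2 M) ^ 2 + 1 := by nlinarith
      calc (n : ℝ) ^ α * (Real.logb 2 n) ^ 2
          ≤ (n : ℝ) ^ α * ((Real.logb 2 M) ^ 2 + 1) := by gcongr
        _ ≤ (n : ℝ) ^ α * ((Real.logb 2 M) ^ 2 + 1) * Real.logb 2 (Real.logb 2 n) :=
            le_mul_of_one_le_right (by positivity) hll
        _ = _ := by ring
    have hle : (1 - α) * (n : ℝ) ^ α ≤ (n : ℝ) ^ α := by nlinarith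
    exact ⟨by linarith [Nat.cast_nonneg (α := ℝ) (ldim (BoolLayers n 1 ⌊(n : ℝ) ^ α⌋₊))],
      by linarith [Nat.cast_nonneg (α := ℝ) (ldim (BoolLayers n 1 (n - ⌊(n : ℝ) ^ α⌋₊)))]⟩
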